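/- Define u_n : U(n) → GL(2n, ℂ) by u_n(X + iY) = [[X, Y], [−Y, X]] (block matrix), for real n×n matrices X, Y such that X + iY is unitary. Then u_n is an injective continuous group homomorphism whose values lie in SO*(2n), the image of u_n equals the centralizer C_{1,n} in SO*(2n) of the image of s_{1,n}, and C_{1,n} is a maximal compact subgroup of SO*(2n) — i.e., C_{1,n} is compact and is not properly contained in any compact subgroup of SO*(2n) — which is isomorphic as a topological group to the unitary group U(n). -/

import Mathlib

open Matrix Complex

noncomputable section

/-- The index `j ∈ {1,…,m}` viewed in the first half of `Fin (2*m)`. -/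
def loIdx (m : ℕ) (j : Fin m) : Fin (2*m) := ⟨j.1, by have := j.2; omega⟩

/-- The index `m + j` in the second half of `Fin (2*m)`. -/
def hiIdx (m : ℕ) (j : Fin m) : Fin (2*m) := ⟨m + j.1, by have := j.2; omega⟩

/-- The quadratic form `z₁² + ⋯ + z_{2m}²`. -/
def QForm (m : ℕ) (z : Fin (2*m) → ℂ) : ℂ := ∑ i, z i ^ 2

/-- The skew-hermitian form
`−z₁ z̄_{m+1} + z_{m+1} z̄₁ − ⋯ − z_m z̄_{2m} + z_{2m} z̄_m`. -/
def HForm (m : ℕ) (z : Fin (2*m) → ℂ) : ℂ :=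
  ∑ j : Fin m,
    (-(z (loIdx m j)) * (starRingEnd ℂ) (z (hiIdx m j)) +
      z (hiIdx m j) * (starRingEnd ℂ) (z (loIdx m j)))

/-- `SO*(2m)` as a set of complex `2m × 2m` matrices: the elements of `SL(2m, ℂ)`
preserving the quadratic form `QForm` and the skew-hermitian form `HForm`. -/
def SOStarSet (m : ℕ) : Set (Matrix (Fin (2*m)) (Fin (2*m)) ℂ) :=
  {g | g.det = 1 ∧ ∀ z, QForm m (g.mulVec z) = QForm m z ∧ HForm m (g.mulVec z) = HForm m z}

/-- The reindexing of coordinates used in the definition of `e_{n,q}`: the coordinate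
`z_a^{(s)}` (`a ∈ Fin (2n)` of the `s`-th copy) is sent to position `s*n + a` if `a < n`
(the "lo" half) and to position `n*q + s*n + (a - n)` otherwise (the "hi" half). -/
def idx (n q : ℕ) (s : Fin q) (a : Fin (2*n)) : Fin (2*(n*q)) :=
  if h : a.1 < n then
    ⟨s.1 * n + a.1, by
      have hs : s.1 + 1 ≤ q := s.2
      calc s.1 * n + a.1 < s.1 * n + n := Nat.add_lt_add_left h _
        _ = (s.1 + 1) * n := by ring
        _ ≤ q * n := Nat.mul_le_mul hs (le_refl n)
        _ = n * q := Nat.mul_comm q n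
        _ ≤ 2 * (n * q) := Nat.le_mul_of_pos_left (n * q) (by norm_num)⟩
  else
    ⟨n * q + (s.1 * n + (a.1 - n)), by
      have hs : s.1 + 1 ≤ q := s.2
      have ha : a.1 - n < n := by have := a.2; omega
      have h1 : s.1 * n + (a.1 - n) < n * q := by
        calc s.1 * n + (a.1 - n) < s.1 * n + n := Nat.add_lt_add_left ha _
          _ = (s.1 + 1) * n := by ring
          _ ≤ q * n := Nat.mul_le_mul hs (le_refl n)
          _ = n * q := Nat.mul_comm q n
      omega⟩

/-- The map `e_{n,q}` : the permuted block-diagonal matrix attached to a `q`-tuple of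
`2n × 2n` matrices. -/
def eMap (n q : ℕ) (g : Fin q → Matrix (Fin (2*n)) (Fin (2*n)) ℂ) :
    Matrix (Fin (2*(n*q))) (Fin (2*(n*q))) ℂ :=
  Matrix.of fun i j =>
    ∑ s : Fin q, ∑ a : Fin (2*n), ∑ b : Fin (2*n),
      if i = idx n q s a ∧ j = idx n q s b then g s a b else 0

/-- The map `s_{n,q}`: `e_{n,q}` precomposed with the diagonal embedding. -/
def sMap (n q : ℕ) (g : Matrix (Fin (2*n)) (Fin (2*n)) ℂ) :
    Matrix (Fin (2*(n*q))) (Fin (2*(n*q))) ℂ :=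
  eMap n q fun _ => g

/-- The map `s_{1,n} : SO*(2) → SO*(2n)` (i.e. `e_{1,n}` precomposed with the diagonal
embedding), written as a map landing in `2n × 2n` matrices via the identification
`2*(1*n) = 2*n` of index sets. -/
def sOneCast (n : ℕ) (h : Matrix (Fin (2*1)) (Fin (2*1)) ℂ) :
    Matrix (Fin (2*n)) (Fin (2*n)) ℂ :=
  (Matrix.reindex (finCongr (by omega : 2*(1*n) = 2*n))
    (finCongr (by omega : 2*(1*n) = 2*n))) (sMap 1 n h)

/-- The centralizer `C_{1,n}` in `SO*(2n)` of the image of `s_{1,n}`. -/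
def Cent (n : ℕ) : Set (Matrix (Fin (2*n)) (Fin (2*n)) ℂ) :=
  {g | g ∈ SOStarSet n ∧ ∀ h ∈ SOStarSet 1, g * sOneCast n h = sOneCast n h * g}

/-- The map `u_n`, sending a complex matrix `A = X + iY` (with `X`, `Y` real) to the
block matrix `[[X, Y], [−Y, X]]`. -/
def uMat (n : ℕ) (A : Matrix (Fin n) (Fin n) ℂ) : Matrix (Fin (2*n)) (Fin (2*n)) ℂ :=
  Matrix.of fun i j =>
    if hi : i.1 < n then
      if hj : j.1 < n then ((A ⟨i.1, hi⟩ ⟨j.1, hj⟩).re : ℂ)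
      else ((A ⟨i.1, hi⟩ ⟨j.1 - n, by have := j.2; omega⟩).im : ℂ)
    else
      if hj : j.1 < n then (-((A ⟨i.1 - n, by have := i.2; omega⟩ ⟨j.1, hj⟩).im) : ℂ)
      else ((A ⟨i.1 - n, by have := i.2; omega⟩ ⟨j.1 - n, by have := j.2; omega⟩).re : ℂ)

section Polarization

variable {ι : Type*} [Fintype ι] [DecidableEq ι]

theorem Matrix.ext_star_dotProduct_mulVec {A B : Matrix ι ι ℂ}
    (h : ∀ z, star z ⬝ᵥ A.mulVec z = star z ⬝ᵥ B.mulVec z) : A = B := by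
  apply (Matrix.toEuclideanLin (𝕜 := ℂ)).injective
  rw [← ext_inner_map]
  intro x
  have := congrArg star (h x.ofLp)
  simp only [EuclideanSpace.inner_eq_star_dotProduct, Matrix.ofLp_toLpLin, toLin'_apply]
  simpa only [← Matrix.star_dotProduct_star, star_star, dotProduct_comm] using this

theorem Matrix.transpose_mul_self_eq_one_of_dotProduct {A : Matrix ι ι ℂ}
    (h : ∀ z, A.mulVec z ⬝ᵥ A.mulVec z = z ⬝ᵥ z) : Aᵀ * A = 1 := by
  have polar : ∀ x y, A.mulVec x ⬝ᵥ A.mulVec y = x ⬝ᵥ y := by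
    intro x y
    have hxy := h (x + y)
    rw [mulVec_add] at hxy
    simp only [add_dotProduct, dotProduct_add, h] at hxy
    rw [dotProduct_comm (A.mulVec y), dotProduct_comm y x] at hxy
    linear_combination hxy / 2
  ext i j
  have := polar (Pi.single i 1) (Pi.single j 1)
  simpa [Matrix.mul_apply, dotProduct, Matrix.one_apply, Pi.single_apply, eq_comm] using this

end Polarization

section CompactGroups

variable {ι : Type*} [Fintype ι] [DecidableEq ι]

open scoped Matrix.Norms.L2Operator

/-- A matrix that does not increase norms, and neither does its inverse, is unitary. -/
theorem Matrix.conjTranspose_mul_self_eq_one_of_norm_le_one {g : Matrix ι ι ℂ}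
    (hg : IsUnit g.det) (h : ‖g‖ ≤ 1) (hinv : ‖g⁻¹‖ ≤ 1) : gᴴ * g = 1 := by
  have bound : ∀ A : Matrix ι ι ℂ, ‖A‖ ≤ 1 → ∀ z : ι → ℂ,
      ‖WithLp.toLp 2 (A.mulVec z)‖ ≤ ‖WithLp.toLp 2 z‖ := fun A hA z =>
    (Matrix.l2_opNorm_mulVec A (WithLp.toLp 2 z)).trans
      (mul_le_of_le_one_left (norm_nonneg _) hA)
  apply Matrix.ext_star_dotProduct_mulVec
  intro z
  have hz : ‖WithLp.toLp 2 (g.mulVec z)‖ = ‖WithLp.toLp 2 z‖ := by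
    refine le_antisymm (bound g h z) ?_
    simpa [mulVec_mulVec, nonsing_inv_mul g hg] using bound g⁻¹ hinv (g.mulVec z)
  have key : ∀ v : ι → ℂ, star v ⬝ᵥ v = (‖WithLp.toLp 2 v‖ : ℂ) ^ 2 := by
    intro v
    have := inner_self_eq_norm_sq_to_K (𝕜 := ℂ) (WithLp.toLp 2 v)
    rw [EuclideanSpace.inner_eq_star_dotProduct, dotProduct_comm] at this
    simpa using this
  rw [one_mulVec, ← mulVec_mulVec, dotProduct_mulVec, ← star_mulVec, key, key, hz]

/-- A compact set of matrices closed under `g ↦ gᴴ * g` lies in the unit ball. -/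
theorem Matrix.norm_le_one_of_isCompact {K : Set (Matrix ι ι ℂ)} (hK : IsCompact K)
    (hstar : ∀ g ∈ K, gᴴ * g ∈ K) {g : Matrix ι ι ℂ} (hg : g ∈ K) : ‖g‖ ≤ 1 := by
  obtain ⟨m, hm, hmax⟩ := hK.exists_isMaxOn ⟨g, hg⟩ continuous_norm.continuousOn
  have h1 : ‖m‖ * ‖m‖ ≤ ‖m‖ := by
    rw [← Matrix.l2_opNorm_conjTranspose_mul_self]
    exact hmax (hstar m hm)
  have h2 : ‖g‖ ≤ ‖m‖ := hmax hg
  nlinarith [norm_nonneg m]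

end CompactGroups

theorem isCompact_unitaryGroup (n : ℕ) :
    IsCompact (Matrix.unitaryGroup (Fin n) ℂ : Set (Matrix (Fin n) (Fin n) ℂ)) := by
  have hball : IsCompact (Set.univ.pi fun _ : Fin n => Set.univ.pi fun _ : Fin n =>
      Metric.closedBall (0 : ℂ) 1) :=
    isCompact_univ_pi fun _ => isCompact_univ_pi fun _ => isCompact_closedBall 0 1
  refine hball.of_isClosed_subset ?_ ?_
  · have : (Matrix.unitaryGroup (Fin n) ℂ : Set (Matrix (Fin n) (Fin n) ℂ)) =
        {A | A * star A = 1} := by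
      ext A
      exact Matrix.mem_unitaryGroup_iff
    rw [this]
    exact isClosed_eq (by fun_prop) continuous_const
  · intro A hA i _ j _
    simpa using entry_norm_bound_of_unitary hA i j

/-- The identification of `Fin (2 * n)` with two copies of `Fin n`. -/
def halfEquiv (n : ℕ) : Fin n ⊕ Fin n ≃ Fin (2 * n) :=
  finSumFinEquiv.trans (finCongr (two_mul n).symm)

@[simp] theorem halfEquiv_inl (n : ℕ) (j : Fin n) : halfEquiv n (Sum.inl j) = loIdx n j := rfl

@[simp] theorem halfEquiv_inr (n : ℕ) (j : Fin n) : halfEquiv n (Sum.inr j) = hiIdx n j := rfl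

@[simp] theorem halfEquiv_symm_loIdx (n : ℕ) (j : Fin n) :
    (halfEquiv n).symm (loIdx n j) = Sum.inl j :=
  (halfEquiv n).symm_apply_apply (Sum.inl j)

@[simp] theorem halfEquiv_symm_hiIdx (n : ℕ) (j : Fin n) :
    (halfEquiv n).symm (hiIdx n j) = Sum.inr j :=
  (halfEquiv n).symm_apply_apply (Sum.inr j)

theorem sum_halfEquiv {n : ℕ} (f : Fin (2 * n) → ℂ) :
    ∑ i, f i = ∑ j, f (loIdx n j) + ∑ j, f (hiIdx n j) := by
  rw [← (halfEquiv n).sum_comp, Fintype.sum_sum_type]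
  rfl

theorem uMat_eq_reindex (n : ℕ) (A : Matrix (Fin n) (Fin n) ℂ) :
    uMat n A = reindex (halfEquiv n) (halfEquiv n)
      (fromBlocks (A.map fun z => (z.re : ℂ)) (A.map fun z => (z.im : ℂ))
        (-A.map fun z => (z.im : ℂ)) (A.map fun z => (z.re : ℂ))) := by
  apply (reindex (halfEquiv n) (halfEquiv n)).symm.injective
  rw [Equiv.symm_apply_apply]
  ext (i | i) (j | j) <;> simp [uMat, loIdx, hiIdx]

theorem uMat_mul (n : ℕ) (A B : Matrix (Fin n) (Fin n) ℂ) :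
    uMat n (A * B) = uMat n A * uMat n B := by
  simp only [uMat_eq_reindex, reindex_apply, submatrix_mul_equiv, fromBlocks_multiply]
  congr 1
  ext (i | i) (j | j) <;>
    simp [Matrix.mul_apply, ← Finset.sum_add_distrib, -Finset.sum_sub_distrib,
      ← Finset.sum_neg_distrib] <;>
    exact Finset.sum_congr rfl fun _ _ => by ring

theorem uMat_one (n : ℕ) : uMat n 1 = 1 := by
  have h0 : (1 : Matrix (Fin n) (Fin n) ℂ).map (fun z => (z.re : ℂ)) = 1 := by
    ext i j; by_cases h : i = j <;> simp [Matrix.one_apply, h]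
  have h1 : (1 : Matrix (Fin n) (Fin n) ℂ).map (fun z => (z.im : ℂ)) = 0 := by
    ext i j; by_cases h : i = j <;> simp [h]
  rw [uMat_eq_reindex, h0, h1]
  simp

theorem uMat_conjTranspose (n : ℕ) (A : Matrix (Fin n) (Fin n) ℂ) :
    uMat n Aᴴ = (uMat n A)ᴴ := by
  simp only [uMat_eq_reindex, reindex_apply, conjTranspose_submatrix, fromBlocks_conjTranspose]
  congr 1
  ext (i | i) (j | j) <;> simp

theorem uMat_transpose (n : ℕ) (A : Matrix (Fin n) (Fin n) ℂ) :
    (uMat n A)ᵀ = (uMat n A)ᴴ := by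
  simp only [uMat_eq_reindex, reindex_apply, conjTranspose_submatrix, fromBlocks_conjTranspose,
    transpose_submatrix, fromBlocks_transpose]
  congr 1
  ext (i | i) (j | j) <;> simp

theorem uMat_injective (n : ℕ) : Function.Injective (uMat n) := by
  intro A B h
  rw [uMat_eq_reindex, uMat_eq_reindex, (reindex _ _).injective.eq_iff, fromBlocks_inj] at h
  ext i j
  exact Complex.ext (by simpa using congrFun₂ h.1 i j) (by simpa using congrFun₂ h.2.1 i j)

theorem continuous_uMat (n : ℕ) : Continuous (uMat n) := by
  refine continuous_matrix fun i j => ?_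
  simp only [uMat, of_apply]
  split_ifs <;> fun_prop

theorem det_uMat (n : ℕ) (A : Matrix (Fin n) (Fin n) ℂ) :
    (uMat n A).det = A.det * star A.det := by
  set X : Matrix (Fin n) (Fin n) ℂ := A.map fun z => (z.re : ℂ) with hX
  set Y : Matrix (Fin n) (Fin n) ℂ := A.map fun z => (z.im : ℂ) with hY
  have hA : X + I • Y = A := by
    ext i j; simp [hX, hY, mul_comm I, Complex.re_add_im]
  have hA' : X - I • Y = A.map star := by
    ext i j; simp [hX, hY, Complex.ext_iff]
  have key : fromBlocks 1 (-I • (1 : Matrix (Fin n) (Fin n) ℂ)) 0 1 * fromBlocks X Y (-Y) X *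
      fromBlocks 1 (I • (1 : Matrix (Fin n) (Fin n) ℂ)) 0 1 =
      fromBlocks A 0 (-Y) (A.map star) := by
    rw [← hA', ← hA]
    simp only [fromBlocks_multiply]
    congr 1 <;> (simp [smul_smul]; try abel)
  have hdet := congrArg det key
  rw [det_mul, det_mul, det_fromBlocks_zero₂₁, det_fromBlocks_zero₂₁, det_fromBlocks_zero₁₂,
    det_one, one_mul, one_mul, mul_one] at hdet
  have hstar : (A.map star).det = star A.det := by
    rw [← det_conjTranspose, ← det_transpose]
    rfl
  rw [uMat_eq_reindex, det_reindex_self, ← hX, ← hY, hdet, hstar]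

/-- The matrix `[[0, 1], [-1, 0]]` representing the skew-hermitian form. -/
def stdJ (n : ℕ) : Matrix (Fin (2 * n)) (Fin (2 * n)) ℂ := uMat n (I • 1)

theorem stdJ_eq_reindex (n : ℕ) :
    stdJ n = reindex (halfEquiv n) (halfEquiv n) (fromBlocks 0 1 (-1) 0) := by
  rw [stdJ, uMat_eq_reindex]
  congr 1
  ext (i | i) (j | j) <;> by_cases h : i = j <;> simp [h]

theorem uMat_mul_stdJ (n : ℕ) (A : Matrix (Fin n) (Fin n) ℂ) :
    uMat n A * stdJ n = stdJ n * uMat n A := by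
  simp [stdJ, ← uMat_mul]

theorem QForm_eq_dotProduct (n : ℕ) (z : Fin (2 * n) → ℂ) : QForm n z = z ⬝ᵥ z := by
  simp [QForm, dotProduct, sq]

theorem HForm_eq_dotProduct (n : ℕ) (z : Fin (2 * n) → ℂ) :
    HForm n z = star z ⬝ᵥ (stdJ n).mulVec z := by
  have hlo : ∀ j, (stdJ n).mulVec z (loIdx n j) = z (hiIdx n j) := by
    intro j
    simp [mulVec, dotProduct, sum_halfEquiv, stdJ_eq_reindex, Matrix.one_apply]
  have hhi : ∀ j, (stdJ n).mulVec z (hiIdx n j) = -z (loIdx n j) := by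
    intro j
    simp [mulVec, dotProduct, sum_halfEquiv, stdJ_eq_reindex, Matrix.one_apply]
  simp only [HForm, dotProduct, sum_halfEquiv, hlo, hhi, ← Finset.sum_add_distrib]
  refine Finset.sum_congr rfl fun j _ => ?_
  simp only [Pi.star_apply, starRingEnd_apply]
  ring

theorem mem_SOStarSet_iff {n : ℕ} {g : Matrix (Fin (2 * n)) (Fin (2 * n)) ℂ} :
    g ∈ SOStarSet n ↔ g.det = 1 ∧ gᵀ * g = 1 ∧ gᴴ * stdJ n * g = stdJ n := by
  have hH : ∀ z, HForm n (g.mulVec z) = star z ⬝ᵥ (gᴴ * stdJ n * g).mulVec z := by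
    intro z
    rw [HForm_eq_dotProduct, star_mulVec, ← dotProduct_mulVec, mulVec_mulVec, mulVec_mulVec,
      Matrix.mul_assoc]
  refine and_congr_right fun _ => ⟨fun h => ⟨?_, ?_⟩, fun h z => ⟨?_, ?_⟩⟩
  · refine transpose_mul_self_eq_one_of_dotProduct fun z => ?_
    simpa only [QForm_eq_dotProduct] using (h z).1
  · refine ext_star_dotProduct_mulVec fun z => ?_
    rw [← hH, (h z).2, HForm_eq_dotProduct]
  · rw [QForm_eq_dotProduct, QForm_eq_dotProduct, dotProduct_mulVec,
      ← mulVec_transpose, mulVec_mulVec, h.1, one_mulVec]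
  · rw [hH, h.2, HForm_eq_dotProduct]

theorem uMat_mem_SOStarSet {n : ℕ} {A : Matrix (Fin n) (Fin n) ℂ}
    (hA : A ∈ Matrix.unitaryGroup (Fin n) ℂ) : uMat n A ∈ SOStarSet n := by
  have hA' : Aᴴ * A = 1 := Matrix.mem_unitaryGroup_iff'.mp hA
  have hU : (uMat n A)ᴴ * uMat n A = 1 := by
    rw [← uMat_conjTranspose, ← uMat_mul, hA', uMat_one]
  refine mem_SOStarSet_iff.mpr ⟨?_, ?_, ?_⟩
  · rw [det_uMat, mul_comm, ← det_conjTranspose, ← det_mul, hA', det_one]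
  · rw [uMat_transpose, hU]
  · rw [Matrix.mul_assoc, ← uMat_mul_stdJ, ← Matrix.mul_assoc, hU, Matrix.one_mul]

/-- A real matrix commuting with `stdJ` lies in the range of `uMat`. -/
theorem exists_uMat_eq {n : ℕ} {g : Matrix (Fin (2 * n)) (Fin (2 * n)) ℂ}
    (hreal : gᵀ = gᴴ) (hJ : g * stdJ n = stdJ n * g) : ∃ A, uMat n A = g := by
  obtain ⟨g, rfl⟩ := (reindex (halfEquiv n) (halfEquiv n)).surjective g
  have hre : ∀ i j, ((g i j).re : ℂ) = g i j := by
    intro i j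
    have := congrFun₂ hreal (halfEquiv n j) (halfEquiv n i)
    exact Complex.conj_eq_iff_re.mp (by simpa using this.symm)
  have hblk : g * fromBlocks 0 1 (-1) 0 = fromBlocks 0 1 (-1) 0 * g := by
    apply (reindex (halfEquiv n) (halfEquiv n)).injective
    simpa [stdJ_eq_reindex] using hJ
  rw [← fromBlocks_toBlocks g] at hblk
  simp only [fromBlocks_multiply, fromBlocks_inj] at hblk
  have h1 : g.toBlocks₂₂ = g.toBlocks₁₁ := by simpa using hblk.2.1.symm
  have h2 : g.toBlocks₂₁ = -g.toBlocks₁₂ := by simpa using hblk.1.symm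
  refine ⟨of fun i j => ⟨(g (Sum.inl i) (Sum.inl j)).re, (g (Sum.inl i) (Sum.inr j)).re⟩, ?_⟩
  rw [uMat_eq_reindex]
  congr 1
  ext (i | i) (j | j)
  · simp [hre]
  · simp [hre]
  · simpa [hre, toBlocks₁₂, toBlocks₂₁] using (congrFun₂ h2 i j).symm
  · simpa [hre, toBlocks₁₁, toBlocks₂₂] using (congrFun₂ h1 i j).symm

/-- A unitary element of `SO*(2n)` lies in the image of `U(n)`. -/
theorem mem_image_uMat {n : ℕ} {g : Matrix (Fin (2 * n)) (Fin (2 * n)) ℂ}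
    (hg : g ∈ SOStarSet n) (hU : gᴴ * g = 1) :
    g ∈ uMat n '' (Matrix.unitaryGroup (Fin n) ℂ : Set (Matrix (Fin n) (Fin n) ℂ)) := by
  obtain ⟨-, hT, hH⟩ := mem_SOStarSet_iff.mp hg
  have hU' : g * gᴴ = 1 := mul_eq_one_comm.mp hU
  have hreal : gᵀ = gᴴ := left_inv_eq_right_inv hT hU'
  have hJ : g * stdJ n = stdJ n * g := by
    conv_lhs => rw [← hH]
    simp only [← Matrix.mul_assoc]
    rw [hU', Matrix.one_mul]
  obtain ⟨A, rfl⟩ := exists_uMat_eq hreal hJ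
  refine ⟨A, Matrix.mem_unitaryGroup_iff'.mpr (uMat_injective n ?_), rfl⟩
  rw [star_eq_conjTranspose, uMat_mul, uMat_conjTranspose, hU, uMat_one]

theorem stdJ_mem_SOStarSet (n : ℕ) : stdJ n ∈ SOStarSet n := by
  refine uMat_mem_SOStarSet (Matrix.mem_unitaryGroup_iff.mpr ?_)
  simp [smul_smul]

theorem isUnit_det_of_mem {n : ℕ} {g : Matrix (Fin (2 * n)) (Fin (2 * n)) ℂ}
    (hg : g ∈ SOStarSet n) : IsUnit g.det :=
  hg.1 ▸ isUnit_one

theorem sOneCast_apply (n : ℕ) (h : Matrix (Fin (2 * 1)) (Fin (2 * 1)) ℂ) :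
    sOneCast n h = reindex (halfEquiv n) (halfEquiv n)
      (fromBlocks (h 0 0 • 1) (h 0 1 • 1) (h 1 0 • 1) (h 1 1 • 1)) := by
  apply (reindex (halfEquiv n) (halfEquiv n)).symm.injective
  rw [Equiv.symm_apply_apply]
  ext (i | i) (j | j) <;>
    simp [sOneCast, sMap, eMap, idx, loIdx, hiIdx, Fin.sum_univ_two, Matrix.one_apply]
  all_goals
    rw [Finset.sum_eq_single i]
    · grind
    · intro x _ hx
      grind
    · simp

theorem sOneCast_stdJ (n : ℕ) : sOneCast n (stdJ 1) = stdJ n := by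
  rw [sOneCast_apply, stdJ_eq_reindex n]
  congr 1
  simp [stdJ, uMat, Matrix.one_apply]

/-- The image of `s_{1,n}` consists of combinations of the identity and `stdJ`. -/
theorem sOneCast_eq_of_mem {h : Matrix (Fin (2 * 1)) (Fin (2 * 1)) ℂ} (hh : h ∈ SOStarSet 1)
    (n : ℕ) : sOneCast n h = h 0 0 • (1 : Matrix (Fin (2 * n)) (Fin (2 * n)) ℂ) +
      h 0 1 • stdJ n := by
  obtain ⟨hdet, hT, -⟩ := mem_SOStarSet_iff.mp hh
  have hadj : hᵀ = h.adjugate := by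
    have := mul_adjugate h
    rw [hdet, one_smul] at this
    exact left_inv_eq_right_inv hT this
  change hᵀ = Matrix.adjugate (n := Fin 2) h at hadj
  rw [adjugate_fin_two] at hadj
  have h00 : h 0 0 = h 1 1 := by simpa using congrFun₂ hadj 0 0
  have h10 : h 1 0 = -h 0 1 := by simpa using congrFun₂ hadj 0 1
  have hone : (1 : Matrix (Fin (2 * n)) (Fin (2 * n)) ℂ) =
      reindex (halfEquiv n) (halfEquiv n) (fromBlocks 1 0 0 1) := by simp
  rw [sOneCast_apply, stdJ_eq_reindex, ← h00, h10, hone]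
  apply (reindex (halfEquiv n) (halfEquiv n)).symm.injective
  ext (i | i) (j | j) <;> simp [-fromBlocks_one]

theorem image_uMat_eq_Cent (n : ℕ) :
    uMat n '' (Matrix.unitaryGroup (Fin n) ℂ : Set (Matrix (Fin n) (Fin n) ℂ)) = Cent n := by
  apply Set.Subset.antisymm
  · rintro _ ⟨A, hA, rfl⟩
    refine ⟨uMat_mem_SOStarSet hA, fun h hh => ?_⟩
    rw [sOneCast_eq_of_mem hh, Matrix.mul_add, Matrix.add_mul]
    simp [uMat_mul_stdJ]
  · rintro g ⟨hg, hcomm⟩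
    have hJ : g * stdJ n = stdJ n * g := by
      simpa only [sOneCast_stdJ] using hcomm (stdJ 1) (stdJ_mem_SOStarSet 1)
    have hH := (mem_SOStarSet_iff.mp hg).2.2
    refine mem_image_uMat hg ?_
    rw [Matrix.mul_assoc, ← hJ, ← Matrix.mul_assoc] at hH
    have hJdet := isUnit_det_of_mem (stdJ_mem_SOStarSet n)
    rw [← Matrix.mul_nonsing_inv_cancel_right _ (gᴴ * g) hJdet, hH, mul_nonsing_inv _ hJdet]

theorem subset_Cent_of_isCompact {n : ℕ} {K : Set (Matrix (Fin (2 * n)) (Fin (2 * n)) ℂ)}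
    (hK : K ⊆ SOStarSet n) (hmul : ∀ a ∈ K, ∀ b ∈ K, a * b ∈ K) (hinv : ∀ a ∈ K, a⁻¹ ∈ K)
    (hcpt : IsCompact K) (hC : Cent n ⊆ K) : K ⊆ Cent n := by
  have hJ : stdJ n ∈ K := hC ⟨stdJ_mem_SOStarSet n, fun h hh => by
    simp [sOneCast_eq_of_mem hh, Matrix.mul_add, Matrix.add_mul]⟩
  have hdet : ∀ g ∈ K, IsUnit g.det := fun g hg => isUnit_det_of_mem (hK hg)
  have hstar : ∀ g ∈ K, gᴴ * g ∈ K := by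
    intro g hg
    have hH := (mem_SOStarSet_iff.mp (hK hg)).2.2
    have : gᴴ = stdJ n * g⁻¹ * (stdJ n)⁻¹ := by
      rw [← hH, Matrix.mul_nonsing_inv_cancel_right _ _ (hdet g hg), hH,
        Matrix.mul_nonsing_inv_cancel_right _ _ (hdet _ hJ)]
    rw [this]
    exact hmul _ (hmul _ (hmul _ hJ _ (hinv g hg)) _ (hinv _ hJ)) _ hg
  intro g hg
  rw [← image_uMat_eq_Cent]
  exact mem_image_uMat (hK hg) (conjTranspose_mul_self_eq_one_of_norm_le_one (hdet g hg)
    (norm_le_one_of_isCompact hcpt hstar hg) (norm_le_one_of_isCompact hcpt hstar (hinv g hg)))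

/-- `u_n : U(n) → GL(2n, ℂ)` is an injective continuous group homomorphism with values
in `SO*(2n)`, its image is the centralizer `C_{1,n}` in `SO*(2n)` of the image of
`s_{1,n}`, and `C_{1,n}` is a maximal compact subgroup of `SO*(2n)`, isomorphic as a
topological group to the unitary group `U(n)`. -/
theorem uMat_image_centralizer_maximal_compact (n : ℕ) (hn : 1 ≤ n) :
    (∀ A : Matrix (Fin n) (Fin n) ℂ,
        A ∈ Matrix.unitaryGroup (Fin n) ℂ → uMat n A ∈ SOStarSet n) ∧
    (∀ A B : Matrix (Fin n) (Fin n) ℂ,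
        A ∈ Matrix.unitaryGroup (Fin n) ℂ → B ∈ Matrix.unitaryGroup (Fin n) ℂ →
          uMat n (A * B) = uMat n A * uMat n B) ∧
    Set.InjOn (uMat n) (Matrix.unitaryGroup (Fin n) ℂ : Set (Matrix (Fin n) (Fin n) ℂ)) ∧
    Continuous (uMat n) ∧
    (uMat n '' (Matrix.unitaryGroup (Fin n) ℂ : Set (Matrix (Fin n) (Fin n) ℂ)) = Cent n) ∧
    IsCompact (Cent n) ∧
    (∀ K : Set (Matrix (Fin (2*n)) (Fin (2*n)) ℂ),
        K ⊆ SOStarSet n → (1 : Matrix (Fin (2*n)) (Fin (2*n)) ℂ) ∈ K →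
        (∀ a ∈ K, ∀ b ∈ K, a * b ∈ K) → (∀ a ∈ K, a⁻¹ ∈ K) →
        IsCompact K → Cent n ⊆ K → K = Cent n) ∧
    (∃ e : Matrix.unitaryGroup (Fin n) ℂ ≃ₜ Cent n,
        ∀ A : Matrix.unitaryGroup (Fin n) ℂ, (e A).1 = uMat n A.1) := by
  have hcompact : IsCompact (Cent n) := by
    rw [← image_uMat_eq_Cent]
    exact (isCompact_unitaryGroup n).image (continuous_uMat n)
  refine ⟨fun A hA => uMat_mem_SOStarSet hA, fun A B _ _ => uMat_mul n A B,
    (uMat_injective n).injOn, continuous_uMat n, image_uMat_eq_Cent n, hcompact,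
    fun K hK _ hmul hinv hcpt hC => (subset_Cent_of_isCompact hK hmul hinv hcpt hC).antisymm hC,
    ?_⟩
  have : CompactSpace (Matrix.unitaryGroup (Fin n) ℂ) :=
    isCompact_iff_compactSpace.mp (isCompact_unitaryGroup n)
  let f : Matrix.unitaryGroup (Fin n) ℂ ≃ Cent n :=
    (Equiv.Set.image (uMat n) (Matrix.unitaryGroup (Fin n) ℂ : Set _) (uMat_injective n)).trans
      (Equiv.setCongr (image_uMat_eq_Cent n))
  have hf : Continuous f :=
    ((continuous_uMat n).comp continuous_subtype_val).subtype_mk _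
  exact ⟨hf.homeoOfEquivCompactToT2, fun A => rfl⟩
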